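/- Let G be a connected graph with 2-forest matrix S, m edges, τ spanning trees, degree vector d, and vertex v. With G̃_v and Ĝ_v as above (pendant twins at v, and the same with edge ab added), the numerators and denominators of formula κ = dᵀSd/(4mτ) satisfy: d̂ᵀŜd̂ = 3·d̃ᵀS̃d̃ + 12·dᵀSe_v + 8mτ + 12τ and 4m̂τ̂ = 3·(4m̃τ̃) + 12τ. -/

import Mathlib

open Matrix SimpleGraph

/-- `T` is a spanning tree of `G`: a subgraph (on the same vertex set) that is
connected and acyclic. -/
def IsSpanningTree {V : Type*} (G T : SimpleGraph V) : Prop :=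
  T ≤ G ∧ T.Connected ∧ T.IsAcyclic

/-- The number of spanning trees of `G`. -/
noncomputable def spanningTreeCount {V : Type*} (G : SimpleGraph V) : ℕ :=
  Nat.card {T : SimpleGraph V // IsSpanningTree G T}

/-- `F` is a spanning 2-forest of `G` separating `i` and `j`: an acyclic subgraph
with exactly two components, one containing `i` and the other containing `j`. -/
def IsTwoForestSep {V : Type*} (G F : SimpleGraph V) (i j : V) : Prop :=
  F ≤ G ∧ F.IsAcyclic ∧ ¬ F.Reachable i j ∧ ∀ x, F.Reachable x i ∨ F.Reachable x j

/-- The `(i,j)` entry of the 2-forest matrix of `G`. -/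
noncomputable def twoForestCount {V : Type*} (G : SimpleGraph V) (i j : V) : ℕ :=
  Nat.card {F : SimpleGraph V // IsTwoForestSep G F i j}

/-- The graph `G̃_v`: `G` with two new pendant vertices attached at `v`. -/
def tildeG {V : Type*} (G : SimpleGraph V) (v : V) : SimpleGraph (V ⊕ Fin 2) :=
  SimpleGraph.fromRel (fun x y =>
    (∃ a b, x = Sum.inl a ∧ y = Sum.inl b ∧ G.Adj a b) ∨
    (x = Sum.inl v ∧ ∃ c, y = Sum.inr c))

/-- The graph `Ĝ_v`: `G` with two new vertices `a, b` adjacent to `v` and to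
each other. -/
def hatG {V : Type*} (G : SimpleGraph V) (v : V) : SimpleGraph (V ⊕ Fin 2) :=
  SimpleGraph.fromRel (fun x y =>
    (∃ a b, x = Sum.inl a ∧ y = Sum.inl b ∧ G.Adj a b) ∨
    (x = Sum.inl v ∧ ∃ c, y = Sum.inr c) ∨
    (x = Sum.inr 0 ∧ y = Sum.inr 1))

/-- The degree vector of `H`, as a real vector. -/
noncomputable def degVec {W : Type*} (H : SimpleGraph W) : W → ℝ :=
  fun i => ((H.neighborSet i).ncard : ℝ)

/-- The number of edges of `H`, as a real number. -/
noncomputable def edgeCount {W : Type*} (H : SimpleGraph W) : ℝ :=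
  (H.edgeSet.ncard : ℝ)

/-- The 2-forest matrix of `H`, as a real matrix. -/
noncomputable def forestMatrix {W : Type*} (H : SimpleGraph W) : Matrix W W ℝ :=
  Matrix.of fun i j => ((twoForestCount H i j : ℝ))

/-- The Kemeny constant of `H`, via the formula `κ = dᵀSd / (4mτ)`. -/
noncomputable def kemeny {W : Type*} [Fintype W] (H : SimpleGraph W) : ℝ :=
  (degVec H ⬝ᵥ (forestMatrix H).mulVec (degVec H)) /
    (4 * edgeCount H * (spanningTreeCount H : ℝ))

/-- The one-point union of `H` and `K`, identifying `v` with `none`. -/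
def glue {V W : Type*} (v : V) (H : SimpleGraph V) (K : SimpleGraph (Option W)) :
    SimpleGraph (V ⊕ W) where
  Adj
    | Sum.inl x, Sum.inl y => H.Adj x y
    | Sum.inl x, Sum.inr w => x = v ∧ K.Adj none (some w)
    | Sum.inr w, Sum.inl x => x = v ∧ K.Adj none (some w)
    | Sum.inr w, Sum.inr w' => K.Adj (some w) (some w')
  symm := ⟨by
    rintro (x | w) (y | w') h
    · exact h.symm
    · exact h
    · exact h
    · exact h.symm⟩
  loopless := ⟨by
    rintro (x | w) h
    · exact H.loopless.irrefl x h
    · exact K.loopless.irrefl _ h⟩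

/-- The retraction of a one-point union onto its left part. -/
def retractLeft {V W : Type*} (v : V) : V ⊕ W → V := Sum.elim id fun _ => v

/-- The retraction of a one-point union onto its right part. -/
def retractRight {V W : Type*} : V ⊕ W → Option W := Sum.elim (fun _ => none) some

/-- The inclusion of the right part into a one-point union. -/
def inclRight {V W : Type*} (v : V) : Option W → V ⊕ W
  | none => Sum.inl v
  | some w => Sum.inr w

section glue

variable {V W : Type*} {v : V}

theorem glue_reachable_inl {H : SimpleGraph V} (K : SimpleGraph (Option W)) {x y : V}
    (h : H.Reachable x y) : (glue v H K).Reachable (Sum.inl x) (Sum.inl y) :=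
  h.map (⟨Sum.inl, fun h => h⟩ : H →g glue v H K)

theorem glue_adj_inclRight {H : SimpleGraph V} {K : SimpleGraph (Option W)} {i j : Option W} :
    (glue v H K).Adj (inclRight v i) (inclRight v j) ↔ K.Adj i j := by
  rcases i with _ | i <;> rcases j with _ | j <;> simp [glue, inclRight, K.adj_comm]

theorem glue_reachable_inclRight (H : SimpleGraph V) {K : SimpleGraph (Option W)}
    {i j : Option W} (h : K.Reachable i j) :
    (glue v H K).Reachable (inclRight v i) (inclRight v j) :=
  h.map (⟨inclRight v, glue_adj_inclRight.2⟩ : K →g glue v H K)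

theorem SimpleGraph.Reachable.of_adj_imp {A B : Type*} {L : SimpleGraph A} {M : SimpleGraph B}
    (f : A → B) (hf : ∀ a b, L.Adj a b → M.Reachable (f a) (f b)) {a b : A}
    (h : L.Reachable a b) : M.Reachable (f a) (f b) := by
  obtain ⟨p⟩ := h
  induction p with
  | nil => rfl
  | cons hadj _ ih => exact (hf _ _ hadj).trans ih

theorem glue_reachable {H : SimpleGraph V} {K : SimpleGraph (Option W)} {a b : V ⊕ W} :
    (glue v H K).Reachable a b ↔
      H.Reachable (retractLeft v a) (retractLeft v b) ∧
        K.Reachable (retractRight a) (retractRight b) := by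
  constructor
  · intro h
    constructor
    · refine h.of_adj_imp _ ?_
      rintro (x | w) (y | w') h
      · exact Adj.reachable h
      · obtain ⟨rfl, -⟩ := h; rfl
      · obtain ⟨rfl, -⟩ := h; rfl
      · rfl
    · refine h.of_adj_imp _ ?_
      rintro (x | w) (y | w') h
      · rfl
      · exact Adj.reachable h.2
      · exact (Adj.reachable h.2).symm
      · exact Adj.reachable h
  · rcases a with x | w <;> rcases b with y | w' <;> rintro ⟨h₁, h₂⟩
    · exact glue_reachable_inl K h₁
    · exact (glue_reachable_inl K h₁).trans (glue_reachable_inclRight (v := v) H h₂)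
    · exact (glue_reachable_inclRight (v := v) H h₂).trans (glue_reachable_inl K h₁)
    · exact glue_reachable_inclRight (v := v) H h₂

theorem glue_le_glue {H H' : SimpleGraph V} {K K' : SimpleGraph (Option W)} :
    glue v H K ≤ glue v H' K' ↔ H ≤ H' ∧ K ≤ K' := by
  constructor
  · refine fun h => ⟨fun x y hxy => @h (Sum.inl x) (Sum.inl y) hxy, fun i j hij => ?_⟩
    exact glue_adj_inclRight.1 (h (glue_adj_inclRight.2 hij))
  · rintro ⟨h₁, h₂⟩ (x | w) (y | w') h
    · exact h₁ h
    · exact ⟨h.1, h₂ h.2⟩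
    · exact ⟨h.1, h₂ h.2⟩
    · exact h₂ h

theorem glue_injective :
    Function.Injective fun p : SimpleGraph V × SimpleGraph (Option W) => glue v p.1 p.2 := by
  intro p q h
  have h₁ := glue_le_glue.1 (le_of_eq h)
  have h₂ := glue_le_glue.1 (ge_of_eq h)
  exact Prod.ext (le_antisymm h₁.1 h₂.1) (le_antisymm h₁.2 h₂.2)

theorem exists_glue_eq_of_le {H : SimpleGraph V} {K : SimpleGraph (Option W)}
    {L : SimpleGraph (V ⊕ W)} (h : L ≤ glue v H K) : ∃ H' K', glue v H' K' = L := by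
  refine ⟨L.comap Sum.inl, L.comap (inclRight v), ?_⟩
  ext (x | w) (y | w')
  · rfl
  · refine ⟨fun h' => h'.1 ▸ h'.2, fun h' => ?_⟩
    obtain ⟨rfl, -⟩ := h h'
    exact ⟨rfl, h'⟩
  · refine ⟨fun h' => Adj.symm (h'.1 ▸ h'.2), fun h' => ?_⟩
    obtain ⟨rfl, -⟩ := h h'
    exact ⟨rfl, Adj.symm h'⟩
  · rfl

theorem glue_deleteEdges_inl {H : SimpleGraph V} {K : SimpleGraph (Option W)} {x y : V} :
    (glue v H K).deleteEdges {s(Sum.inl x, Sum.inl y)} = glue v (H.deleteEdges {s(x, y)}) K := by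
  ext (a | w) (b | w') <;> simp [glue]

theorem glue_deleteEdges_inclRight {H : SimpleGraph V} {K : SimpleGraph (Option W)}
    {i j : Option W} (hij : i ≠ j) :
    (glue v H K).deleteEdges {s(inclRight v i, inclRight v j)} =
      glue v H (K.deleteEdges {s(i, j)}) := by
  ext (a | w) (b | w') <;> rcases i with _ | i <;> rcases j with _ | j <;>
    simp [glue, inclRight] at hij ⊢ <;> grind

theorem retractLeft_inclRight (i : Option W) : retractLeft v (inclRight v i) = v := by
  cases i <;> rfl

theorem retractRight_inclRight (i : Option W) : retractRight (inclRight v i) = i := by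
  cases i <;> rfl

theorem glue_isAcyclic {H : SimpleGraph V} {K : SimpleGraph (Option W)} :
    (glue v H K).IsAcyclic ↔ H.IsAcyclic ∧ K.IsAcyclic := by
  simp only [isAcyclic_iff_forall_adj_isBridge, isBridge_iff]
  have hl {x y : V} : ¬ ((glue v H K).deleteEdges {s(Sum.inl x, Sum.inl y)}).Reachable
      (Sum.inl x) (Sum.inl y) ↔ ¬ (H.deleteEdges {s(x, y)}).Reachable x y := by
    rw [glue_deleteEdges_inl, glue_reachable]
    simp [retractLeft, retractRight]
  have hr {i j : Option W} (hij : i ≠ j) :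
      ¬ ((glue v H K).deleteEdges {s(inclRight v i, inclRight v j)}).Reachable
        (inclRight v i) (inclRight v j) ↔ ¬ (K.deleteEdges {s(i, j)}).Reachable i j := by
    rw [glue_deleteEdges_inclRight hij, glue_reachable]
    simp [retractLeft_inclRight, retractRight_inclRight]
  constructor
  · refine fun h => ⟨fun x y hxy => hl.1 (h hxy), fun i j hij => (hr hij.ne).1 (h ?_)⟩
    exact glue_adj_inclRight.2 hij
  · rintro ⟨h₁, h₂⟩ (x | w) (y | w') h
    · exact hl.2 (h₁ h)
    · obtain ⟨rfl, h⟩ := h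
      exact (hr h.ne).2 (h₂ h)
    · obtain ⟨rfl, h⟩ := h
      exact (hr h.symm.ne).2 (h₂ h.symm)
    · exact (hr (Adj.ne h)).2 (h₂ h)

theorem glue_connected {H : SimpleGraph V} {K : SimpleGraph (Option W)} :
    (glue v H K).Connected ↔ H.Connected ∧ K.Connected := by
  constructor
  · intro h
    refine ⟨?_, ?_⟩
    · have : Nonempty V := ⟨v⟩
      exact ⟨fun x y => (glue_reachable.1 (h.preconnected (Sum.inl x) (Sum.inl y))).1⟩
    · refine ⟨fun i j => ?_⟩
      have := (glue_reachable.1 (h.preconnected (inclRight v i) (inclRight v j))).2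
      rwa [retractRight_inclRight, retractRight_inclRight] at this
  · rintro ⟨h₁, h₂⟩
    have : Nonempty (V ⊕ W) := ⟨Sum.inl v⟩
    exact ⟨fun a b => glue_reachable.2 ⟨h₁.preconnected _ _, h₂.preconnected _ _⟩⟩

theorem glue_isSpanningTree {G H : SimpleGraph V} {M K : SimpleGraph (Option W)} :
    IsSpanningTree (glue v G M) (glue v H K) ↔ IsSpanningTree G H ∧ IsSpanningTree M K := by
  simp only [IsSpanningTree, glue_le_glue, glue_connected, glue_isAcyclic]
  tauto

theorem IsSpanningTree.reachable {G T : SimpleGraph V} (h : IsSpanningTree G T) (x y : V) :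
    T.Reachable x y := h.2.1.preconnected x y

theorem IsSpanningTree.of_reachable {G T : SimpleGraph V} (hle : T ≤ G) (hac : T.IsAcyclic) (v : V)
    (h : ∀ x, T.Reachable x v) : IsSpanningTree G T :=
  have : Nonempty V := ⟨v⟩
  ⟨hle, ⟨fun x y => (h x).trans (h y).symm⟩, hac⟩

theorem glue_isTwoForestSep_inl {G H : SimpleGraph V} {M K : SimpleGraph (Option W)} {x y : V} :
    IsTwoForestSep (glue v G M) (glue v H K) (Sum.inl x) (Sum.inl y) ↔
      IsTwoForestSep G H x y ∧ IsSpanningTree M K := by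
  constructor
  · rintro ⟨hle, hac, hn, hc⟩
    rw [glue_le_glue] at hle
    rw [glue_isAcyclic] at hac
    simp only [glue_reachable] at hn hc
    refine ⟨⟨hle.1, hac.1, fun h => hn ⟨h, .rfl⟩, fun z => ?_⟩,
      IsSpanningTree.of_reachable hle.2 hac.2 none fun i => ?_⟩
    · exact (hc (Sum.inl z)).imp And.left And.left
    · have := (hc (inclRight v i)).elim And.right And.right
      rwa [retractRight_inclRight] at this
  · rintro ⟨⟨hle, hac, hn, hc⟩, ht⟩
    refine ⟨glue_le_glue.2 ⟨hle, ht.1⟩, glue_isAcyclic.2 ⟨hac, ht.2.2⟩,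
      fun h => hn (glue_reachable.1 h).1, fun a => ?_⟩
    simp only [glue_reachable]
    exact (hc (retractLeft v a)).imp (fun h => ⟨h, ht.reachable _ _⟩)
      (fun h => ⟨h, ht.reachable _ _⟩)

theorem glue_isTwoForestSep_inr {G H : SimpleGraph V} {M K : SimpleGraph (Option W)} {w w' : W} :
    IsTwoForestSep (glue v G M) (glue v H K) (Sum.inr w) (Sum.inr w') ↔
      IsSpanningTree G H ∧ IsTwoForestSep M K (some w) (some w') := by
  constructor
  · rintro ⟨hle, hac, hn, hc⟩
    rw [glue_le_glue] at hle
    rw [glue_isAcyclic] at hac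
    simp only [glue_reachable] at hn hc
    refine ⟨IsSpanningTree.of_reachable hle.1 hac.1 v fun x => ?_,
      hle.2, hac.2, fun h => hn ⟨.rfl, h⟩, fun i => ?_⟩
    · exact (hc (Sum.inl x)).elim And.left And.left
    · have := (hc (inclRight v i)).imp And.right And.right
      rwa [retractRight_inclRight] at this
  · rintro ⟨ht, ⟨hle, hac, hn, hc⟩⟩
    refine ⟨glue_le_glue.2 ⟨ht.1, hle⟩, glue_isAcyclic.2 ⟨ht.2.2, hac⟩,
      fun h => hn (glue_reachable.1 h).2, fun a => ?_⟩
    simp only [glue_reachable]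
    exact (hc (retractRight a)).imp (fun h => ⟨ht.reachable _ _, h⟩)
      (fun h => ⟨ht.reachable _ _, h⟩)

theorem glue_isTwoForestSep_inl_inr {G H : SimpleGraph V} {M K : SimpleGraph (Option W)}
    {x : V} {w : W} :
    IsTwoForestSep (glue v G M) (glue v H K) (Sum.inl x) (Sum.inr w) ↔
      (IsTwoForestSep G H x v ∧ IsSpanningTree M K) ∨
        (IsSpanningTree G H ∧ IsTwoForestSep M K none (some w)) := by
  constructor
  · rintro ⟨hle, hac, hn, hc⟩
    rw [glue_le_glue] at hle
    rw [glue_isAcyclic] at hac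
    simp only [glue_reachable] at hn hc
    have hcl (z : V) : _ := hc (Sum.inl z)
    have hcr (i : Option W) : _ := hc (inclRight v i)
    simp only [retractLeft_inclRight, retractRight_inclRight] at hcr
    simp only [retractLeft, retractRight, Sum.elim_inl, Sum.elim_inr, id] at hn hcl hcr
    by_cases hx : H.Reachable x v
    · have hK : ¬ K.Reachable none (some w) := fun h => hn ⟨hx, h⟩
      refine Or.inr ⟨IsSpanningTree.of_reachable hle.1 hac.1 x fun z => ?_,
        hle.2, hac.2, hK, fun i => (hcr i).imp And.right And.right⟩
      exact (hcl z).elim And.left fun h => absurd h.2 hK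
    · refine Or.inl ⟨⟨hle.1, hac.1, hx, fun z => (hcl z).imp And.left And.left⟩,
        IsSpanningTree.of_reachable hle.2 hac.2 (some w) fun i => ?_⟩
      exact (hcr i).elim (fun h => absurd h.1.symm hx) And.right
  · rintro (⟨⟨hle, hac, hn, hc⟩, ht⟩ | ⟨ht, ⟨hle, hac, hn, hc⟩⟩)
    · refine ⟨glue_le_glue.2 ⟨hle, ht.1⟩, glue_isAcyclic.2 ⟨hac, ht.2.2⟩,
        fun h => hn (glue_reachable.1 h).1, fun a => ?_⟩
      simp only [glue_reachable]
      exact (hc (retractLeft v a)).imp (fun h => ⟨h, ht.reachable _ _⟩)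
        (fun h => ⟨h, ht.reachable _ _⟩)
    · refine ⟨glue_le_glue.2 ⟨ht.1, hle⟩, glue_isAcyclic.2 ⟨ht.2.2, hac⟩,
        fun h => hn (glue_reachable.1 h).2, fun a => ?_⟩
      simp only [glue_reachable]
      exact (hc (retractRight a)).imp (fun h => ⟨ht.reachable _ _, h⟩)
        (fun h => ⟨ht.reachable _ _, h⟩)

theorem card_subgraphs_glue {G : SimpleGraph V} {M : SimpleGraph (Option W)}
    (P : SimpleGraph (V ⊕ W) → Prop) (hP : ∀ L, P L → L ≤ glue v G M) :
    Nat.card {L // P L} =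
      Nat.card {p : SimpleGraph V × SimpleGraph (Option W) // P (glue v p.1 p.2)} := by
  symm
  refine Nat.card_congr (Equiv.ofBijective (fun p => ⟨glue v p.1.1 p.1.2, p.2⟩) ⟨?_, ?_⟩)
  · intro p q h
    exact Subtype.ext (glue_injective (Subtype.ext_iff.1 h))
  · rintro ⟨L, hL⟩
    obtain ⟨H, K, rfl⟩ := exists_glue_eq_of_le (hP L hL)
    exact ⟨⟨(H, K), hL⟩, rfl⟩

theorem card_subtype_and {A B : Type*} (P : A → Prop) (Q : B → Prop) :
    Nat.card {p : A × B // P p.1 ∧ Q p.2} = Nat.card {a // P a} * Nat.card {b // Q b} := by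
  rw [← Nat.card_prod]
  exact Nat.card_congr Equiv.subtypeProdEquivProd

theorem spanningTreeCount_glue (G : SimpleGraph V) (M : SimpleGraph (Option W)) :
    spanningTreeCount (glue v G M) = spanningTreeCount G * spanningTreeCount M := by
  unfold spanningTreeCount
  rw [card_subgraphs_glue _ fun L hL => hL.1]
  simp only [glue_isSpanningTree]
  exact card_subtype_and _ _

theorem twoForestCount_glue_inl (G : SimpleGraph V) (M : SimpleGraph (Option W)) (x y : V) :
    twoForestCount (glue v G M) (Sum.inl x) (Sum.inl y) =
      twoForestCount G x y * spanningTreeCount M := by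
  unfold spanningTreeCount twoForestCount
  rw [card_subgraphs_glue _ fun L hL => hL.1]
  simp only [glue_isTwoForestSep_inl]
  exact card_subtype_and (IsTwoForestSep G · x y) (IsSpanningTree M)

theorem twoForestCount_glue_inr (G : SimpleGraph V) (M : SimpleGraph (Option W)) (w w' : W) :
    twoForestCount (glue v G M) (Sum.inr w) (Sum.inr w') =
      spanningTreeCount G * twoForestCount M (some w) (some w') := by
  unfold spanningTreeCount twoForestCount
  rw [card_subgraphs_glue _ fun L hL => hL.1]
  simp only [glue_isTwoForestSep_inr]
  exact card_subtype_and (IsSpanningTree G) (IsTwoForestSep M · (some w) (some w'))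

theorem twoForestCount_glue_inl_inr [Finite V] [Finite W] (G : SimpleGraph V)
    (M : SimpleGraph (Option W)) (x : V) (w : W) :
    twoForestCount (glue v G M) (Sum.inl x) (Sum.inr w) =
      twoForestCount G x v * spanningTreeCount M +
        spanningTreeCount G * twoForestCount M none (some w) := by
  unfold spanningTreeCount twoForestCount
  rw [card_subgraphs_glue _ fun L hL => hL.1]
  simp only [glue_isTwoForestSep_inl_inr]
  classical
  rw [← card_subtype_and (IsTwoForestSep G · x v), ← card_subtype_and (IsSpanningTree G),
    ← Nat.card_sum]
  refine Nat.card_congr (subtypeOrEquiv _ _ ?_)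
  rw [Pi.disjoint_iff]
  intro p
  rw [Prop.disjoint_iff]
  rintro ⟨h₁, h₂⟩
  exact h₁.1.2.2.1 (h₂.1.reachable _ _)

end glue

theorem twoForestCount_comm {V : Type*} (G : SimpleGraph V) (i j : V) :
    twoForestCount G i j = twoForestCount G j i := by
  unfold twoForestCount IsTwoForestSep
  simp only [or_comm, reachable_comm (u := i) (v := j)]

theorem twoForestCount_self {V : Type*} (G : SimpleGraph V) (i : V) :
    twoForestCount G i i = 0 := by
  have : IsEmpty {F : SimpleGraph V // IsTwoForestSep G F i i} :=
    ⟨fun F => F.2.2.2.1 .rfl⟩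
  exact Nat.card_of_isEmpty

/-- The adjacency function of the graph on `Option (Fin 2)` in which `e.1`, `e.2.1`, `e.2.2`
tell whether `{none, 0}`, `{none, 1}`, `{0, 1}` are edges. -/
def triAdj (e : Bool × Bool × Bool) : Option (Fin 2) → Option (Fin 2) → Bool
  | none, some 0 => e.1
  | some 0, none => e.1
  | none, some 1 => e.2.1
  | some 1, none => e.2.1
  | some 0, some 1 => e.2.2
  | some 1, some 0 => e.2.2
  | _, _ => false

/-- The graph on `Option (Fin 2)` with the prescribed edges. -/
def triGraph (e : Bool × Bool × Bool) : SimpleGraph (Option (Fin 2)) where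
  Adj i j := triAdj e i j
  symm := ⟨by revert e; decide⟩
  loopless := ⟨by revert e; decide⟩

instance (e : Bool × Bool × Bool) : DecidableRel (triGraph e).Adj :=
  fun i j => inferInstanceAs (Decidable (triAdj e i j = true))

theorem triGraph_bijective : Function.Bijective triGraph := by
  classical
  constructor
  · intro e e' h
    have key (i j : Option (Fin 2)) : triAdj e i j = triAdj e' i j := by
      have : (triGraph e).Adj i j ↔ (triGraph e').Adj i j := by rw [h]
      exact Bool.eq_iff_iff.2 this
    exact Prod.ext (key none (some 0)) (Prod.ext (key none (some 1)) (key (some 0) (some 1)))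
  · intro K
    refine ⟨(decide (K.Adj none (some 0)), decide (K.Adj none (some 1)),
      decide (K.Adj (some 0) (some 1))), ?_⟩
    ext i j
    change triAdj _ i j = true ↔ _
    rcases i with _ | i <;> rcases j with _ | j
    · simp [triAdj]
    · fin_cases j <;> simp [triAdj]
    · fin_cases i <;> simp [triAdj, K.adj_comm]
    · fin_cases i <;> fin_cases j <;> simp [triAdj, K.adj_comm]

theorem reachable_option_fin_two {K : SimpleGraph (Option (Fin 2))} {i j : Option (Fin 2)} :
    K.Reachable i j ↔ i = j ∨ K.Adj i j ∨ ∃ k, K.Adj i k ∧ K.Adj k j := by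
  constructor
  · rintro ⟨p⟩
    induction p with
    | nil => exact Or.inl rfl
    | @cons a b c hab _ ih =>
      by_cases hac : a = c
      · exact Or.inl hac
      · rcases ih with rfl | hbc | ⟨k, hbk, hkc⟩
        · exact Or.inr (Or.inl hab)
        · exact Or.inr (Or.inr ⟨b, hab, hbc⟩)
        · have aux : ∀ a b c k : Option (Fin 2),
              a ≠ c → a ≠ b → b ≠ k → k ≠ c → k = a ∨ b = c := by decide
          rcases aux a b c k hac hab.ne hbk.ne hkc.ne with rfl | rfl
          · exact Or.inr (Or.inl hkc)
          · exact Or.inr (Or.inl hab)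
  · rintro (rfl | h | ⟨k, h₁, h₂⟩)
    · rfl
    · exact h.reachable
    · exact h₁.reachable.trans h₂.reachable

/-- Reachability in `triGraph e`, as a decidable relation. -/
abbrev TriReach (e : Bool × Bool × Bool) (i j : Option (Fin 2)) : Prop :=
  i = j ∨ triAdj e i j ∨ ∃ k, triAdj e i k ∧ triAdj e k j

theorem triGraph_reachable {e : Bool × Bool × Bool} {i j : Option (Fin 2)} :
    (triGraph e).Reachable i j ↔ TriReach e i j := reachable_option_fin_two

theorem triGraph_le {e e' : Bool × Bool × Bool} : triGraph e ≤ triGraph e' ↔ e ≤ e' := by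
  have : triGraph e ≤ triGraph e' ↔ ∀ i j, triAdj e i j → triAdj e' i j :=
    Iff.rfl
  rw [this]
  clear this
  revert e e'
  decide

theorem triGraph_isAcyclic {e : Bool × Bool × Bool} :
    (triGraph e).IsAcyclic ↔ e ≠ (true, true, true) := by
  have (i j : Option (Fin 2)) : ((triGraph e).deleteEdges {s(i, j)}).Reachable i j ↔
      i = j ∨ ∃ k, (triAdj e i k ∧ k ≠ j) ∧ (triAdj e k j ∧ k ≠ i) := by
    rw [reachable_option_fin_two]
    simp only [deleteEdges_adj, triGraph]
    by_cases h : i = j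
    · simp [h]
    · simp only [h, Set.mem_singleton_iff, not_true_eq_false, and_false, false_or]
      grind
  simp only [isAcyclic_iff_forall_adj_isBridge, isBridge_iff, this]
  change (∀ i j, triAdj e i j = true → _) ↔ _
  clear this
  revert e
  decide

theorem triGraph_isSpanningTree {e e' : Bool × Bool × Bool} :
    IsSpanningTree (triGraph e) (triGraph e') ↔
      e' ≤ e ∧ (∀ i j, TriReach e' i j) ∧ e' ≠ (true, true, true) := by
  rw [IsSpanningTree, triGraph_le, triGraph_isAcyclic, connected_iff]
  have : Nonempty (Option (Fin 2)) := ⟨none⟩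
  simp [Preconnected, triGraph_reachable, this]

theorem triGraph_isTwoForestSep {e e' : Bool × Bool × Bool} {i j : Option (Fin 2)} :
    IsTwoForestSep (triGraph e) (triGraph e') i j ↔
      e' ≤ e ∧ e' ≠ (true, true, true) ∧ ¬ TriReach e' i j ∧
        ∀ x, TriReach e' x i ∨ TriReach e' x j := by
  simp only [IsTwoForestSep, triGraph_le, triGraph_isAcyclic, triGraph_reachable]

theorem card_subtype_triGraph (P : SimpleGraph (Option (Fin 2)) → Prop)
    (Q : Bool × Bool × Bool → Prop) [DecidablePred Q] (h : ∀ e, P (triGraph e) ↔ Q e) :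
    Nat.card {K // P K} = Fintype.card {e // Q e} := by
  rw [← Nat.card_eq_fintype_card]
  exact (Nat.card_congr ((Equiv.ofBijective _ triGraph_bijective).subtypeEquiv
    fun e => (h e).symm)).symm

theorem spanningTreeCount_triGraph (e : Bool × Bool × Bool) :
    spanningTreeCount (triGraph e) =
      Fintype.card {e' // e' ≤ e ∧ (∀ i j, TriReach e' i j) ∧ e' ≠ (true, true, true)} :=
  card_subtype_triGraph _ _ fun _ => triGraph_isSpanningTree

theorem twoForestCount_triGraph (e : Bool × Bool × Bool) (i j : Option (Fin 2)) :
    twoForestCount (triGraph e) i j =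
      Fintype.card {e' // e' ≤ e ∧ e' ≠ (true, true, true) ∧ ¬ TriReach e' i j ∧
        ∀ x, TriReach e' x i ∨ TriReach e' x j} :=
  card_subtype_triGraph _ _ fun _ => triGraph_isTwoForestSep

theorem spanningTreeCount_path : spanningTreeCount (triGraph (true, true, false)) = 1 := by
  rw [spanningTreeCount_triGraph]; decide

theorem spanningTreeCount_triangle : spanningTreeCount (triGraph (true, true, true)) = 3 := by
  rw [spanningTreeCount_triGraph]; decide

theorem twoForestCount_path_none (c : Fin 2) :
    twoForestCount (triGraph (true, true, false)) none (some c) = 1 := by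
  rw [twoForestCount_triGraph]; revert c; decide

theorem twoForestCount_triangle {i j : Option (Fin 2)} (h : i ≠ j) :
    twoForestCount (triGraph (true, true, true)) i j = 2 := by
  rw [twoForestCount_triGraph]; revert i j; decide

theorem twoForestCount_path_some {c d : Fin 2} (h : c ≠ d) :
    twoForestCount (triGraph (true, true, false)) (some c) (some d) = 2 := by
  rw [twoForestCount_triGraph]; revert c d; decide

theorem tildeG_eq_glue {V : Type*} (G : SimpleGraph V) (v : V) :
    tildeG G v = glue v G (triGraph (true, true, false)) := by
  ext (x | c) (y | d)
  · simp only [tildeG, fromRel_adj, glue]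
    have := @Adj.ne V G x y
    simp [G.adj_comm y x]
    tauto
  · fin_cases d <;> simp [tildeG, glue, triGraph, triAdj]
  · fin_cases c <;> simp [tildeG, glue, triGraph, triAdj]
  · fin_cases c <;> fin_cases d <;> simp [tildeG, glue, triGraph, triAdj]

theorem hatG_eq_glue {V : Type*} (G : SimpleGraph V) (v : V) :
    hatG G v = glue v G (triGraph (true, true, true)) := by
  ext (x | c) (y | d)
  · simp only [hatG, fromRel_adj, glue]
    have := @Adj.ne V G x y
    simp [G.adj_comm y x]
    tauto
  · fin_cases d <;> simp [hatG, glue, triGraph, triAdj]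
  · fin_cases c <;> simp [hatG, glue, triGraph, triAdj]
  · fin_cases c <;> fin_cases d <;> simp [hatG, glue, triGraph, triAdj]

theorem degVec_eq_sum {V : Type*} [Fintype V] (G : SimpleGraph V) [DecidableRel G.Adj] (x : V) :
    degVec G x = ∑ y, if G.Adj x y then 1 else 0 := by
  rw [degVec, Set.ncard_eq_toFinset_card', Finset.sum_boole]
  congr 2
  ext y
  simp

theorem sum_degVec {V : Type*} [Fintype V] (G : SimpleGraph V) :
    ∑ x, degVec G x = 2 * edgeCount G := by
  classical
  have h := G.sum_degrees_eq_twice_card_edges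
  rw [edgeCount, Set.ncard_eq_toFinset_card', ← edgeFinset]
  have h' : ∀ x, degVec G x = G.degree x := fun x => by
    rw [degVec, Set.ncard_eq_toFinset_card']; rfl
  simp only [h']
  exact_mod_cast h

theorem degVec_glue_inl {V W : Type*} [Fintype V] [DecidableEq V] [Fintype W] (v : V)
    (H : SimpleGraph V) (K : SimpleGraph (Option W)) (x : V) :
    degVec (glue v H K) (Sum.inl x) = degVec H x + if x = v then degVec K none else 0 := by
  classical
  simp only [degVec_eq_sum, Fintype.sum_sum_type, Fintype.sum_option]
  by_cases h : x = v
  · simp [glue, h, -Finset.sum_boole]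
  · simp [glue, h, -Finset.sum_boole]
    exact Finset.sum_congr rfl fun _ _ => by congr

theorem degVec_glue_inr {V W : Type*} [Fintype V] [Fintype W] (v : V)
    (H : SimpleGraph V) (K : SimpleGraph (Option W)) (w : W) :
    degVec (glue v H K) (Sum.inr w) = degVec K (some w) := by
  classical
  simp only [degVec_eq_sum, Fintype.sum_sum_type, Fintype.sum_option]
  by_cases h : K.Adj none (some w)
  all_goals
    simp [glue, h, K.adj_comm (some w) none, -Finset.sum_boole]
    exact Finset.sum_congr rfl fun _ _ => by congr

theorem edgeCount_glue {V W : Type*} [Fintype V] [Fintype W] (v : V)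
    (H : SimpleGraph V) (K : SimpleGraph (Option W)) :
    edgeCount (glue v H K) = edgeCount H + edgeCount K := by
  classical
  have h := sum_degVec (glue v H K)
  rw [Fintype.sum_sum_type] at h
  simp only [degVec_glue_inl, degVec_glue_inr, Finset.sum_add_distrib, sum_degVec,
    Finset.sum_ite_eq', Finset.mem_univ, if_true] at h
  have h' := sum_degVec K
  rw [Fintype.sum_option] at h'
  linarith

theorem degVec_triangle (i : Option (Fin 2)) : degVec (triGraph (true, true, true)) i = 2 := by
  have : ∀ i, (Finset.univ.filter ((triGraph (true, true, true)).Adj i)).card = 2 := by decide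
  rw [degVec_eq_sum, Finset.sum_boole, this]
  norm_num

theorem degVec_path_none : degVec (triGraph (true, true, false)) none = 2 := by
  have : (Finset.univ.filter ((triGraph (true, true, false)).Adj none)).card = 2 := by decide
  rw [degVec_eq_sum, Finset.sum_boole, this]
  norm_num

theorem degVec_path_some (c : Fin 2) : degVec (triGraph (true, true, false)) (some c) = 1 := by
  have : ∀ c, (Finset.univ.filter ((triGraph (true, true, false)).Adj (some c))).card = 1 := by
    decide
  rw [degVec_eq_sum, Finset.sum_boole, this]
  norm_num

theorem edgeCount_triangle : edgeCount (triGraph (true, true, true)) = 3 := by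
  have h := sum_degVec (triGraph (true, true, true))
  norm_num [Fintype.sum_option, degVec_triangle] at h
  linarith

theorem edgeCount_path : edgeCount (triGraph (true, true, false)) = 2 := by
  have h := sum_degVec (triGraph (true, true, false))
  norm_num [Fintype.sum_option, degVec_path_none, degVec_path_some] at h
  linarith

/-- The quadratic form `dᵀSd` of a one-point union with a graph on three vertices, in which the
two vertices outside `G` have the same degree `q` and the same 2-forest counts. -/
theorem degVec_dotProduct_forestMatrix_glue {V : Type*} [Fintype V] [DecidableEq V]
    (G : SimpleGraph V) (v : V) (K : SimpleGraph (Option (Fin 2))) {p q t r s : ℝ}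
    (hp : degVec K none = p) (hq : ∀ c, degVec K (some c) = q)
    (ht : (spanningTreeCount K : ℝ) = t)
    (hr : ∀ c, (twoForestCount K none (some c) : ℝ) = r)
    (hs : ∀ c d, c ≠ d → (twoForestCount K (some c) (some d) : ℝ) = s) :
    degVec (glue v G K) ⬝ᵥ (forestMatrix (glue v G K)).mulVec (degVec (glue v G K)) =
      t * (degVec G ⬝ᵥ (forestMatrix G).mulVec (degVec G))
        + (2 * p * t + 4 * q * t) * (degVec G ⬝ᵥ (forestMatrix G).mulVec (Pi.single v 1))
        + 4 * q * r * (2 * edgeCount G + p) * (spanningTreeCount G : ℝ)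
        + 2 * q ^ 2 * s * (spanningTreeCount G : ℝ) := by
  have hrl (x : V) (c : Fin 2) : (twoForestCount (glue v G K) (Sum.inr c) (Sum.inl x) : ℝ) =
      twoForestCount G x v * t + spanningTreeCount G * r := by
    rw [twoForestCount_comm, twoForestCount_glue_inl_inr]
    push_cast [ht, hr]
    rfl
  have hlr (x : V) (c : Fin 2) : (twoForestCount (glue v G K) (Sum.inl x) (Sum.inr c) : ℝ) =
      twoForestCount G x v * t + spanningTreeCount G * r := by
    rw [twoForestCount_comm, hrl]
  have hll (x y : V) : (twoForestCount (glue v G K) (Sum.inl x) (Sum.inl y) : ℝ) =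
      twoForestCount G x y * t := by
    rw [twoForestCount_glue_inl]
    push_cast [ht]
    rfl
  have h01 : (twoForestCount (glue v G K) (Sum.inr 0) (Sum.inr 1) : ℝ) =
      spanningTreeCount G * s := by
    rw [twoForestCount_glue_inr]
    push_cast [hs 0 1 (by decide)]
    rfl
  have h10 : (twoForestCount (glue v G K) (Sum.inr 1) (Sum.inr 0) : ℝ) =
      spanningTreeCount G * s := by
    rw [twoForestCount_comm, h01]
  have hsymm (x : V) : (twoForestCount G v x : ℝ) = twoForestCount G x v := by
    rw [twoForestCount_comm]
  set S : V → V → ℝ := fun x y => ((twoForestCount G x y : ℕ) : ℝ) with hS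
  set d := degVec G with hd
  set τ : ℝ := ((spanningTreeCount G : ℕ) : ℝ) with hτ
  set B : ℝ := ∑ x, d x * S x v with hB
  have hm : ∑ x, d x = 2 * edgeCount G := sum_degVec G
  have hv : S v v = 0 := by simp [hS, twoForestCount_self]
  have hcol : degVec G ⬝ᵥ (forestMatrix G).mulVec (Pi.single v 1) = B := by
    simp [dotProduct, forestMatrix, hB, hS, hd]
  have hBv : ∑ y, S v y * d y = B :=
    Finset.sum_congr rfl fun y _ => by rw [mul_comm]; simp only [hS, twoForestCount_comm G v y]
  have hrow (x : V) : ∑ y, S x y * t * (d y + if y = v then p else 0) =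
      t * ∑ y, S x y * d y + S x v * t * p := by
    simp only [mul_add, Finset.sum_add_distrib, mul_ite, mul_zero, Finset.sum_ite_eq',
      Finset.mem_univ, if_true, Finset.mul_sum]
    congr 1
    exact Finset.sum_congr rfl fun y _ => by ring
  have hrow' : ∑ y, (S y v * t + τ * r) * (d y + if y = v then p else 0) =
      t * B + τ * r * (2 * edgeCount G + p) := by
    simp only [mul_add, Finset.sum_add_distrib, mul_ite, mul_zero, Finset.sum_ite_eq',
      Finset.mem_univ, if_true, hB, ← hm, Finset.mul_sum, hv, zero_mul, zero_add, ← add_assoc]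
    rw [← Finset.sum_add_distrib]
    congr 1
    exact Finset.sum_congr rfl fun y _ => by ring
  have hout (f : V → ℝ) : ∑ x, (d x + if x = v then p else 0) * f x =
      ∑ x, d x * f x + p * f v := by
    simp [add_mul, Finset.sum_add_distrib]
  have hsum (R : V → ℝ) :
      ∑ x, d x * (t * R x + S x v * t * p + ((S x v * t + τ * r) * q + (S x v * t + τ * r) * q)) =
        t * ∑ x, d x * R x + (p * t + 2 * q * t) * B + 2 * (τ * r * q) * (2 * edgeCount G) := by
    rw [← hm, hB]
    simp only [Finset.mul_sum, ← Finset.sum_add_distrib]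
    exact Finset.sum_congr rfl fun x _ => by ring
  rw [hcol]
  simp only [dotProduct, mulVec, forestMatrix, Matrix.of_apply, Fintype.sum_sum_type,
    Fin.sum_univ_two, degVec_glue_inl, degVec_glue_inr, hp, hq, hrl, hlr, hll, h01, h10,
    twoForestCount_self, Nat.cast_zero, zero_mul, zero_add, add_zero]
  change ∑ x, (d x + if x = v then p else 0) * (∑ y, S x y * t * (d y + if y = v then p else 0) +
        ((S x v * t + τ * r) * q + (S x v * t + τ * r) * q)) +
      (q * (∑ y, (S y v * t + τ * r) * (d y + if y = v then p else 0) + τ * s * q) +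
        q * (∑ y, (S y v * t + τ * r) * (d y + if y = v then p else 0) + τ * s * q)) =
    t * ∑ x, d x * ∑ y, S x y * d y + _ + _ + _
  rw [hrow']
  simp only [hrow]
  rw [hout, hsum, hBv, hv]
  ring

theorem hat_numerator_denominator {V : Type*} [Fintype V] [DecidableEq V]
    (G : SimpleGraph V) (hG : G.Connected) (v : V) :
    degVec (hatG G v) ⬝ᵥ (forestMatrix (hatG G v)).mulVec (degVec (hatG G v))
      = 3 * (degVec (tildeG G v) ⬝ᵥ
          (forestMatrix (tildeG G v)).mulVec (degVec (tildeG G v)))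
        + 12 * (degVec G ⬝ᵥ (forestMatrix G).mulVec (Pi.single v 1))
        + 8 * edgeCount G * (spanningTreeCount G : ℝ)
        + 12 * (spanningTreeCount G : ℝ) ∧
    4 * edgeCount (hatG G v) * (spanningTreeCount (hatG G v) : ℝ)
      = 3 * (4 * edgeCount (tildeG G v) * (spanningTreeCount (tildeG G v) : ℝ))
        + 12 * (spanningTreeCount G : ℝ) := by
  rw [hatG_eq_glue, tildeG_eq_glue]
  constructor
  · rw [degVec_dotProduct_forestMatrix_glue G v _ (p := 2) (q := 2) (t := 3) (r := 2) (s := 2)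
        (degVec_triangle _) (fun _ => degVec_triangle _)
        (by rw [spanningTreeCount_triangle]; norm_num)
        (fun c => by rw [twoForestCount_triangle (Option.some_ne_none c).symm]; norm_num)
        (fun c d h => by rw [twoForestCount_triangle (by simpa using h)]; norm_num),
      degVec_dotProduct_forestMatrix_glue G v _ (p := 2) (q := 1) (t := 1) (r := 1) (s := 2)
        degVec_path_none degVec_path_some
        (by rw [spanningTreeCount_path]; norm_num)
        (fun c => by rw [twoForestCount_path_none]; norm_num)
        (fun c d h => by rw [twoForestCount_path_some h]; norm_num)]
    ring
  · simp only [edgeCount_glue, spanningTreeCount_glue, edgeCount_triangle, edgeCount_path,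
      spanningTreeCount_triangle, spanningTreeCount_path]
    push_cast
    ring
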